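/- For every real polynomial F in two variables of total degree ≤ 2n−1, ∫_{[-1,1]²} F(x₁+x₂, x₁x₂) (x₁−x₂)² w(x₁)w(x₂) dx₁dx₂ = 2 Σ_{1 ≤ j < k ≤ n+1} λ_j λ_k (t_j − t_k)² F(t_j+t_k, t_j t_k). The points {(t_j+t_k, t_j t_k) : 1 ≤ j < k ≤ n+1} are pairwise distinct, so this is (under the change of variables u = (x₁+x₂, x₁x₂)) a cubature rule of degree 2n−1 for the weight 𝒲_{1/2} on Ω with exactly n(n+1)/2 nodes, i.e. a Gauss cubature rule attaining the lower bound dim Π²_{n-1} = n(n+1)/2. -/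

import Mathlib

open MeasureTheory Set

/-- A quadrature rule exact in degree `D` tensorizes to a cubature rule on the square that is exact
for the polynomials of degree at most `D` in each of the two variables. -/
theorem integral_prod_eq_sum_of_degreeOf_le {ι : Type*} [Fintype ι] (w : ℝ → ℝ) {a b : ℝ}
    (hw_int : IntegrableOn w (Icc a b)) {D : ℕ} (t lam : ι → ℝ)
    (hquad : ∀ g : Polynomial ℝ, g.natDegree ≤ D →
      (∫ s in Icc a b, g.eval s * w s) = ∑ k, lam k * g.eval (t k))
    (G : MvPolynomial (Fin 2) ℝ) (hG : ∀ i, G.degreeOf i ≤ D) :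
    (∫ x in Icc a b ×ˢ Icc a b,
      MvPolynomial.eval ![x.1, x.2] G * (w x.1 * w x.2)) =
      ∑ j, ∑ k, lam j * lam k * MvPolynomial.eval ![t j, t k] G := by
  have hpow (d : ℕ) (hd : d ≤ D) :
      (∫ s in Icc a b, s ^ d * w s) = ∑ k, lam k * t k ^ d := by
    simpa using hquad (Polynomial.X ^ d) (by simpa using hd)
  have hint (d : ℕ) : Integrable (fun s => s ^ d * w s) (volume.restrict (Icc a b)) :=
    hw_int.continuousOn_mul (by fun_prop) isCompact_Icc
  have hexp (x y : ℝ) : MvPolynomial.eval ![x, y] G =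
      ∑ m ∈ G.support, G.coeff m * (x ^ m 0 * y ^ m 1) := by
    simp [MvPolynomial.eval_eq']
  have hle (m : Fin 2 →₀ ℕ) (hm : m ∈ G.support) (i : Fin 2) : m i ≤ D :=
    (MvPolynomial.degreeOf_le_iff.1 (hG i)) m hm
  rw [Measure.volume_eq_prod, ← Measure.prod_restrict]
  calc
    _ = ∫ x, ∑ m ∈ G.support, G.coeff m * ((x.1 ^ m 0 * w x.1) * (x.2 ^ m 1 * w x.2))
          ∂((volume.restrict (Icc a b)).prod (volume.restrict (Icc a b))) := by
      refine integral_congr_ae (.of_forall fun x => ?_)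
      simp only [hexp, Finset.sum_mul]
      exact Finset.sum_congr rfl fun m _ => by ring
    _ = ∑ m ∈ G.support, G.coeff m *
          ((∑ j, lam j * t j ^ m 0) * ∑ k, lam k * t k ^ m 1) := by
      rw [integral_finsetSum _ fun m _ => ((hint (m 0)).mul_prod (hint (m 1))).const_mul _]
      refine Finset.sum_congr rfl fun m hm => ?_
      rw [integral_const_mul, integral_prod_mul (fun s => s ^ m 0 * w s) (fun s => s ^ m 1 * w s),
        hpow _ (hle m hm 0), hpow _ (hle m hm 1)]
    _ = _ := by
      simp only [hexp, Finset.sum_mul_sum]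
      simp only [Finset.mul_sum]
      rw [Finset.sum_comm]
      refine Finset.sum_congr rfl fun j _ => ?_
      rw [Finset.sum_comm]
      exact Finset.sum_congr rfl fun k _ => Finset.sum_congr rfl fun m _ => by ring

/-- Substituting polynomials of degree at most one in the variable `i` gives a polynomial whose
degree in `i` is at most the total degree of the original one. -/
theorem MvPolynomial.degreeOf_bind₁_le_totalDegree {R σ τ : Type*} [CommSemiring R]
    (f : σ → MvPolynomial τ R) (i : τ) (hf : ∀ s, (f s).degreeOf i ≤ 1) (F : MvPolynomial σ R) :
    (MvPolynomial.bind₁ f F).degreeOf i ≤ F.totalDegree := by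
  have hF : MvPolynomial.bind₁ f F =
      ∑ m ∈ F.support, MvPolynomial.C (F.coeff m) * ∏ s ∈ m.support, f s ^ m s := by
    rw [MvPolynomial.bind₁, MvPolynomial.aeval_def, MvPolynomial.eval₂_eq]
    rfl
  rw [hF]
  refine (MvPolynomial.degreeOf_sum_le i _ _).trans (Finset.sup_le fun m hm => ?_)
  refine (MvPolynomial.degreeOf_C_mul_le _ i _).trans ?_
  refine (MvPolynomial.degreeOf_prod_le i _ _).trans ?_
  refine le_trans (Finset.sum_le_sum fun s _ => ?_) (MvPolynomial.le_totalDegree hm)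
  calc (f s ^ m s).degreeOf i ≤ m s * (f s).degreeOf i := MvPolynomial.degreeOf_pow_le i _ _
    _ ≤ m s * 1 := Nat.mul_le_mul_left _ (hf s)
    _ = m s := mul_one _

/-- A double sum of a symmetric function vanishing on the diagonal is twice the sum over the
strictly increasing pairs. -/
theorem Finset.sum_sum_eq_two_mul_sum_filter_lt {ι R : Type*} [Fintype ι] [LinearOrder ι]
    [CommSemiring R] (f : ι → ι → R) (hsymm : ∀ j k, f j k = f k j) (hdiag : ∀ j, f j j = 0) :
    ∑ j, ∑ k, f j k = 2 * ∑ q ∈ Finset.univ.filter (fun q : ι × ι => q.1 < q.2), f q.1 q.2 := by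
  have hsplit (j k : ι) : f j k = (if j < k then f j k else 0) + if k < j then f k j else 0 := by
    rcases lt_trichotomy j k with h | rfl | h
    · simp [h, h.not_gt]
    · simp [hdiag]
    · simp [h, h.not_gt, hsymm j k]
  have hswap : ∑ j, ∑ k, (if k < j then f k j else 0) = ∑ j, ∑ k, if j < k then f j k else 0 :=
    Finset.sum_comm
  rw [Finset.sum_filter, Fintype.sum_prod_type, two_mul]
  conv_lhs => enter [2, j, 2, k]; rw [hsplit]
  simp only [Finset.sum_add_distrib]
  rw [hswap]

/-- An ordered pair of nodes is determined by its sum and product. -/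
theorem injOn_add_mul_of_injective {ι R : Type*} [Preorder ι] [CommRing R] [IsDomain R]
    {t : ι → R} (ht : Function.Injective t) :
    Set.InjOn (fun q : ι × ι => (t q.1 + t q.2, t q.1 * t q.2)) {q : ι × ι | q.1 < q.2} := by
  rintro ⟨j, k⟩ hjk ⟨j', k'⟩ hjk' h
  simp only [Prod.mk.injEq, Set.mem_ofPred_eq] at h hjk hjk'
  obtain ⟨hs, hp⟩ := h
  have hprod : (t j - t j') * (t j - t k') = 0 := by linear_combination t j * hs - hp
  rcases mul_eq_zero.1 hprod with h | h
  · have hk : t k = t k' := by linear_combination hs - h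
    rw [ht (sub_eq_zero.1 h), ht hk]
  · have hk : t k = t j' := by linear_combination hs - h
    rw [ht (sub_eq_zero.1 h), ht hk] at hjk
    exact absurd hjk hjk'.not_gt

theorem stmt4 (w : ℝ → ℝ)
    (hw_nonneg : ∀ t ∈ Icc (-1:ℝ) 1, 0 ≤ w t)
    (hw_int : IntegrableOn w (Icc (-1:ℝ) 1))
    (hw_ne : ¬ (w =ᵐ[volume.restrict (Icc (-1:ℝ) 1)] 0))
    (n : ℕ) (hn : 1 ≤ n)
    (t : Fin (n+1) → ℝ) (lam : Fin (n+1) → ℝ)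
    (ht : ∀ k, t k ∈ Ioo (-1:ℝ) 1) (htinj : Function.Injective t)
    (hlam : ∀ k, 0 < lam k)
    (hquad : ∀ g : Polynomial ℝ, g.natDegree ≤ 2*n + 1 →
      (∫ s in Icc (-1:ℝ) 1, g.eval s * w s) = ∑ k, lam k * g.eval (t k)) :
    -- the Gauss cubature rule of degree 2n−1 for 𝒲_{1/2}
    (∀ F : MvPolynomial (Fin 2) ℝ, F.totalDegree ≤ 2*n - 1 →
      (∫ x in (Icc (-1:ℝ) 1) ×ˢ (Icc (-1:ℝ) 1),
        MvPolynomial.eval ![x.1 + x.2, x.1 * x.2] F * ((x.1 - x.2)^2 * (w x.1 * w x.2))) =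
      2 * ∑ q ∈ Finset.univ.filter (fun q : Fin (n+1) × Fin (n+1) => q.1 < q.2),
        lam q.1 * lam q.2 * (t q.1 - t q.2)^2 *
          MvPolynomial.eval ![t q.1 + t q.2, t q.1 * t q.2] F) ∧
    -- the n(n+1)/2 nodes (u_{jk}, v_{jk}) for j < k are pairwise distinct
    Set.InjOn (fun q : Fin (n+1) × Fin (n+1) => (t q.1 + t q.2, t q.1 * t q.2))
      {q : Fin (n+1) × Fin (n+1) | q.1 < q.2} := by
  refine ⟨fun F hF => ?_, injOn_add_mul_of_injective htinj⟩
  let S : Fin 2 → MvPolynomial (Fin 2) ℝ :=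
    ![MvPolynomial.X 0 + MvPolynomial.X 1, MvPolynomial.X 0 * MvPolynomial.X 1]
  let V : MvPolynomial (Fin 2) ℝ := MvPolynomial.X 0 - MvPolynomial.X 1
  have hS (i s : Fin 2) : (S s).degreeOf i ≤ 1 := by
    fin_cases s
    · exact (MvPolynomial.degreeOf_add_le i _ _).trans
        (by fin_cases i <;> simp [MvPolynomial.degreeOf_X])
    · exact (MvPolynomial.degreeOf_mul_le i _ _).trans
        (by fin_cases i <;> simp [MvPolynomial.degreeOf_X])
  have hV (i : Fin 2) : V.degreeOf i ≤ 1 :=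
    (MvPolynomial.degreeOf_sub_le i _ _).trans
      (by fin_cases i <;> simp [MvPolynomial.degreeOf_X])
  have hdeg (i : Fin 2) : (MvPolynomial.bind₁ S F * V ^ 2).degreeOf i ≤ 2 * n + 1 := by
    have h₁ := MvPolynomial.degreeOf_mul_le i (MvPolynomial.bind₁ S F) (V ^ 2)
    have h₂ := MvPolynomial.degreeOf_pow_le i V 2
    have h₃ := MvPolynomial.degreeOf_bind₁_le_totalDegree S i (hS i) F
    have h₄ := hV i
    omega
  have heval (x y : ℝ) : MvPolynomial.eval ![x, y] (MvPolynomial.bind₁ S F * V ^ 2) =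
      MvPolynomial.eval ![x + y, x * y] F * (x - y) ^ 2 := by
    have hpt : (fun s => MvPolynomial.eval ![x, y] (S s)) = ![x + y, x * y] := by
      ext s
      fin_cases s <;> simp [S]
    have hF : MvPolynomial.eval ![x, y] (MvPolynomial.bind₁ S F) =
        MvPolynomial.eval ![x + y, x * y] F := by
      rw [← hpt]
      exact MvPolynomial.eval₂Hom_bind₁ (RingHom.id ℝ) _ _ _
    simp [hF, V]
  have hcub := integral_prod_eq_sum_of_degreeOf_le w hw_int t lam hquad _ hdeg
  simp only [heval] at hcub
  simp only [← mul_assoc] at hcub ⊢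
  rw [hcub, Finset.sum_sum_eq_two_mul_sum_filter_lt]
  · exact congrArg _ (Finset.sum_congr rfl fun q _ => by ring)
  · intro j k
    rw [add_comm (t j), mul_comm (t j)]
    ring
  · simp
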